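/- arXiv:2602.12788 — 6 statements merged into one kernel-verified Lean document; each statement's English description precedes it below -/
import Mathlib

section
/- Under the stated hypotheses (Fréchet differentiability of G on D*, χ-Hölder continuity of G' with constant λ, invertibility of G'_{u*} with inverse Γ*, υ = κλφ^χ ≤ χ₀, and the closed ball of radius ϱ = φ(1+χ)(1−υ)/((1+χ)−(2+χ)υ) around u* contained in D*), there exists a sequence (u⁽ⁿ⁾) in X with u⁽⁰⁾ = u* such that for every n ≥ 0: u⁽ⁿ⁾ lies in the closed ball of radius ϱ around u*, the derivative G'_{u⁽ⁿ⁾} admits a continuous linear inverse, and u⁽ⁿ⁺¹⁾ = u⁽ⁿ⁾ − (G'_{u⁽ⁿ⁾})⁻¹ G(u⁽ⁿ⁾); moreover the sequence (u⁽ⁿ⁾) converges to some u in the closed ball of radius ϱ around u* satisfying G(u) = 0. -/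
/-- First-order Taylor remainder bound for a map with Hölder continuous derivative. -/
theorem norm_taylor_remainder_le_of_holder {X Y : Type*}
    [NormedAddCommGroup X] [NormedSpace ℝ X] [NormedAddCommGroup Y] [NormedSpace ℝ Y]
    {D : Set X} (hD : Convex ℝ D) {G : X → Y} {G' : X → X →L[ℝ] Y}
    (hdiff : ∀ u ∈ D, HasFDerivAt G (G' u) u) {χ lam : ℝ} (hχ : 0 < χ)
    (hHolder : ∀ u₁ ∈ D, ∀ u₂ ∈ D, ‖G' u₁ - G' u₂‖ ≤ lam * ‖u₁ - u₂‖ ^ χ)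
    {u v : X} (hu : u ∈ D) (hv : v ∈ D) :
    ‖G v - G u - G' u (v - u)‖ ≤ lam / (1 + χ) * ‖v - u‖ ^ (1 + χ) := by
  set h := v - u with hh
  have hmem : ∀ t ∈ Set.Icc (0 : ℝ) 1, u + t • h ∈ D := fun t ht =>
    hD.add_smul_sub_mem hu hv ht
  have hder : ∀ t ∈ Set.Icc (0 : ℝ) 1,
      HasDerivAt (fun t : ℝ => G (u + t • h) - G u - t • G' u h)
        (G' (u + t • h) h - G' u h) t := by
    intro t ht
    have hline : HasDerivAt (fun t : ℝ => u + t • h) h t := by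
      simpa using ((hasDerivAt_id t).smul_const h).const_add u
    have hlin : HasDerivAt (fun t : ℝ => t • G' u h) (G' u h) t := by
      simpa using (hasDerivAt_id t).smul_const (G' u h)
    exact (((hdiff _ (hmem t ht)).comp_hasDerivAt t hline).sub_const (G u)).sub hlin
  have hB : ∀ t : ℝ, HasDerivAt
      (fun t : ℝ => lam / (1 + χ) * ‖h‖ ^ (1 + χ) * t ^ (1 + χ))
      (lam * ‖h‖ ^ (1 + χ) * t ^ χ) t := by
    intro t
    have hpow := (Real.hasDerivAt_rpow_const (x := t) (p := 1 + χ)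
      (Or.inr (by linarith))).const_mul (lam / (1 + χ) * ‖h‖ ^ (1 + χ))
    have hcoef : lam / (1 + χ) * ‖h‖ ^ (1 + χ) * ((1 + χ) * t ^ (1 + χ - 1)) =
        lam * ‖h‖ ^ (1 + χ) * t ^ χ := by
      rw [add_sub_cancel_left]
      field_simp
    exact hcoef ▸ hpow
  have key := image_norm_le_of_norm_deriv_right_le_deriv_boundary
    (f := fun t : ℝ => G (u + t • h) - G u - t • G' u h)
    (f' := fun t => G' (u + t • h) h - G' u h) (a := 0) (b := 1)
    (fun t ht => (hder t ht).continuousAt.continuousWithinAt)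
    (fun t ht => (hder t ⟨ht.1, ht.2.le⟩).hasDerivWithinAt)
    (B := fun t : ℝ => lam / (1 + χ) * ‖h‖ ^ (1 + χ) * t ^ (1 + χ))
    (B' := fun t => lam * ‖h‖ ^ (1 + χ) * t ^ χ)
    (by simp [Real.zero_rpow (by linarith : 1 + χ ≠ 0)]) hB
    (by
      intro t ht
      have hop := (G' (u + t • h) - G' u).le_opNorm h
      rw [sub_apply] at hop
      refine hop.trans ?_
      have hol := hHolder _ (hmem t ⟨ht.1, ht.2.le⟩) _ hu
      rw [add_sub_cancel_left, norm_smul, Real.norm_of_nonneg ht.1,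
        Real.mul_rpow ht.1 (norm_nonneg _)] at hol
      calc ‖G' (u + t • h) - G' u‖ * ‖h‖ ≤ lam * (t ^ χ * ‖h‖ ^ χ) * ‖h‖ := by gcongr
        _ = lam * ‖h‖ ^ (1 + χ) * t ^ χ := by
          rw [Real.rpow_add_of_nonneg (norm_nonneg _) zero_le_one hχ.le, Real.rpow_one]
          ring)
  have h1 := key (x := 1) (by simp)
  simpa [hh] using h1

/-- Banach's perturbation lemma: an operator `B` with `‖Γ‖ * ‖A - B‖ ≤ a < 1`, where `Γ` is the
inverse of `A`, is invertible, and its inverse has norm at most `‖Γ‖ / (1 - a)`. -/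
theorem exists_inverse_norm_le_of_perturbation {X Y : Type*}
    [NormedAddCommGroup X] [NormedSpace ℝ X] [CompleteSpace X]
    [NormedAddCommGroup Y] [NormedSpace ℝ Y] {A B : X →L[ℝ] Y} {Γ : Y →L[ℝ] X}
    (hl : ∀ x, Γ (A x) = x) (hr : ∀ y, A (Γ y) = y) {a : ℝ} (ha : a < 1)
    (hAB : ‖Γ‖ * ‖A - B‖ ≤ a) :
    ∃ Δ : Y →L[ℝ] X, (∀ x, Δ (B x) = x) ∧ (∀ y, B (Δ y) = y) ∧ ‖Δ‖ ≤ ‖Γ‖ / (1 - a) := by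
  set t : X →L[ℝ] X := Γ.comp (A - B) with ht
  have htn : ‖t‖ ≤ a := (ContinuousLinearMap.opNorm_comp_le _ _).trans hAB
  let U := Units.oneSub t (htn.trans_lt ha)
  have hU : ∀ x, (U : X →L[ℝ] X) x = Γ (B x) := by
    intro x
    simp [U, ht, hl]
  have hinvU : ∀ x, (↑U⁻¹ : X →L[ℝ] X) ((U : X →L[ℝ] X) x) = x := fun x => by
    rw [← mul_apply_eq_comp, U.inv_mul, one_apply_eq_self]
  have hUinv : ∀ x, (U : X →L[ℝ] X) ((↑U⁻¹ : X →L[ℝ] X) x) = x := fun x => by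
    rw [← mul_apply_eq_comp, U.mul_inv, one_apply_eq_self]
  have hB : ∀ y, B ((↑U⁻¹ : X →L[ℝ] X) (Γ y)) = y := fun y => by
    rw [← hr (B _), ← hU, hUinv, hr]
  refine ⟨(↑U⁻¹ : X →L[ℝ] X).comp Γ, fun x => ?_, hB, ?_⟩
  · rw [ContinuousLinearMap.comp_apply, ← hU, hinvU]
  · have h1a : 0 < 1 - a := by linarith
    refine ContinuousLinearMap.opNorm_le_bound _ (by positivity) fun y => ?_
    rw [ContinuousLinearMap.comp_apply]
    set x := (↑U⁻¹ : X →L[ℝ] X) (Γ y) with hx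
    have hsplit : x = t x + Γ y := by
      have : t x = x - Γ y := by simp [ht, hl, hx, hB]
      rw [this]; abel
    have h1 : ‖x‖ ≤ a * ‖x‖ + ‖Γ‖ * ‖y‖ :=
      calc ‖x‖ = ‖t x + Γ y‖ := by rw [← hsplit]
        _ ≤ ‖t x‖ + ‖Γ y‖ := norm_add_le _ _
        _ ≤ a * ‖x‖ + ‖Γ‖ * ‖y‖ :=
          add_le_add (t.le_of_opNorm_le htn x) (Γ.le_opNorm y)
    rw [div_mul_eq_mul_div, le_div_iff₀ h1a]
    linarith

/-- One Newton step: if `‖Γ‖ * lam * ‖Γ (G u)‖ ^ χ ≤ a`, then the derivative at the next iterate is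
invertible, the next correction is smaller by the factor `a / ((1 + χ) * (1 - a))`, and
the smallness condition persists. -/
theorem newton_step_of_holder {X Y : Type*}
    [NormedAddCommGroup X] [NormedSpace ℝ X] [CompleteSpace X]
    [NormedAddCommGroup Y] [NormedSpace ℝ Y]
    {D : Set X} (hD : Convex ℝ D) {G : X → Y} {G' : X → X →L[ℝ] Y}
    (hdiff : ∀ u ∈ D, HasFDerivAt G (G' u) u) {χ lam : ℝ} (hχ : 0 < χ) (hlam : 0 ≤ lam)
    (hHolder : ∀ u₁ ∈ D, ∀ u₂ ∈ D, ‖G' u₁ - G' u₂‖ ≤ lam * ‖u₁ - u₂‖ ^ χ)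
    {a : ℝ} (ha0 : 0 ≤ a) (ha1 : a < 1) (hq : (a / ((1 + χ) * (1 - a))) ^ χ ≤ 1 - a)
    {u v : X} (hu : u ∈ D) (hv : v ∈ D) {Γ : Y →L[ℝ] X}
    (hl : ∀ x, Γ (G' u x) = x) (hr : ∀ y, G' u (Γ y) = y)
    (huv : v = u - Γ (G u)) (hsmall : ‖Γ‖ * lam * ‖Γ (G u)‖ ^ χ ≤ a) :
    ∃ Δ : Y →L[ℝ] X, (∀ x, Δ (G' v x) = x) ∧ (∀ y, G' v (Δ y) = y) ∧
      ‖Δ (G v)‖ ≤ a / ((1 + χ) * (1 - a)) * ‖Γ (G u)‖ ∧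
      ‖Δ‖ * lam * ‖Δ (G v)‖ ^ χ ≤ a := by
  set s := ‖Γ (G u)‖ with hs
  have h1a : 0 < 1 - a := by linarith
  have hs0 : 0 ≤ s := norm_nonneg _
  have hvu : v - u = -Γ (G u) := by rw [huv]; abel
  have hnorm : ‖v - u‖ = s := by rw [hvu, norm_neg]
  obtain ⟨Δ, hΔl, hΔr, hΔn⟩ := exists_inverse_norm_le_of_perturbation (B := G' v) hl hr ha1 (by
    calc ‖Γ‖ * ‖G' u - G' v‖ ≤ ‖Γ‖ * (lam * ‖u - v‖ ^ χ) := by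
          gcongr; exact hHolder u hu v hv
      _ = ‖Γ‖ * lam * s ^ χ := by rw [norm_sub_rev, hnorm, mul_assoc]
      _ ≤ a := hsmall)
  have hGv : ‖G v‖ ≤ lam / (1 + χ) * s ^ (1 + χ) := by
    have h := norm_taylor_remainder_le_of_holder hD hdiff hχ hHolder hu hv
    rw [hnorm, hvu, map_neg, hr] at h
    simpa using h
  have hstep : ‖Δ (G v)‖ ≤ a / ((1 + χ) * (1 - a)) * s :=
    calc ‖Δ (G v)‖ ≤ ‖Δ‖ * ‖G v‖ := Δ.le_opNorm _
      _ ≤ ‖Γ‖ / (1 - a) * (lam / (1 + χ) * s ^ (1 + χ)) := by gcongr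
      _ = ‖Γ‖ * lam * s ^ χ / ((1 + χ) * (1 - a)) * s := by
        rw [Real.rpow_add_of_nonneg hs0 zero_le_one hχ.le, Real.rpow_one]
        field_simp
      _ ≤ a / ((1 + χ) * (1 - a)) * s := by gcongr
  refine ⟨Δ, hΔl, hΔr, hstep, ?_⟩
  have hq0 : 0 ≤ a / ((1 + χ) * (1 - a)) := by positivity
  calc ‖Δ‖ * lam * ‖Δ (G v)‖ ^ χ
      ≤ ‖Γ‖ / (1 - a) * lam * (a / ((1 + χ) * (1 - a)) * s) ^ χ := by gcongr
    _ = (‖Γ‖ * lam * s ^ χ) * ((a / ((1 + χ) * (1 - a))) ^ χ / (1 - a)) := by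
      rw [Real.mul_rpow hq0 hs0]; ring
    _ ≤ a * 1 := by
      gcongr
      rwa [div_le_one h1a]
    _ = a := mul_one a

/-- The contraction factor condition follows from lying below the root `w`. -/
theorem rpow_contraction_factor_le {χ a w : ℝ} (hχ : 0 < χ) (ha0 : 0 ≤ a) (haw : a ≤ w)
    (hw : w < 1) (hroot : (1 + χ) ^ χ * (1 - w) ^ (1 + χ) - w ^ χ = 0) :
    (a / ((1 + χ) * (1 - a))) ^ χ ≤ 1 - a := by
  have h1a : 0 < 1 - a := by linarith
  have h1w : 0 ≤ 1 - w := by linarith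
  have h1χ : 0 < 1 + χ := by linarith
  rw [Real.div_rpow ha0 (by positivity), Real.mul_rpow h1χ.le h1a.le, div_le_iff₀ (by positivity)]
  calc a ^ χ ≤ w ^ χ := by gcongr
    _ = (1 + χ) ^ χ * (1 - w) ^ (1 + χ) := by linarith
    _ ≤ (1 + χ) ^ χ * (1 - a) ^ (1 + χ) := by gcongr
    _ = (1 - a) * ((1 + χ) ^ χ * (1 - a) ^ χ) := by
      rw [Real.rpow_add h1a, Real.rpow_one]; ring


/-- Generalized Newton–Kantorovich theorem (existence part): under χ-Hölder continuity of
the Fréchet derivative, invertibility of `G'` at `u*`, the smallness condition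
`υ = κλφ^χ ≤ χ₀` and `closedBall u* ϱ ⊆ D*` with `ϱ = φ(1+χ)(1-υ)/((1+χ)-(2+χ)υ)`,
the Newton iterates starting at `u*` are well-defined, stay in the closed ball of radius
`ϱ` around `u*`, and converge to a zero of `G` in that ball. -/
theorem stmt_1 {X Y : Type*}
    [NormedAddCommGroup X] [NormedSpace ℝ X] [CompleteSpace X]
    [NormedAddCommGroup Y] [NormedSpace ℝ Y] [CompleteSpace Y]
    (Dstar : Set X) (hDopen : IsOpen Dstar) (hDconv : Convex ℝ Dstar)
    (G : X → Y) (G' : X → X →L[ℝ] Y)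
    (hdiff : ∀ u ∈ Dstar, HasFDerivAt G (G' u) u)
    (χ lam : ℝ) (hχ : χ ∈ Set.Ioc (0:ℝ) 1) (hlam : 0 < lam)
    (hHolder : ∀ u₁ ∈ Dstar, ∀ u₂ ∈ Dstar,
      ‖G' u₁ - G' u₂‖ ≤ lam * ‖u₁ - u₂‖ ^ χ)
    (ustar : X) (hustar : ustar ∈ Dstar)
    (Γstar : Y →L[ℝ] X)
    (hΓ_left : ∀ x : X, Γstar (G' ustar x) = x)
    (hΓ_right : ∀ y : Y, G' ustar (Γstar y) = y)
    (κ φ υ χ₀ ϱ : ℝ)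
    (hκ : κ = ‖Γstar‖) (hφ : φ = ‖Γstar (G ustar)‖)
    (hυ : υ = κ * lam * φ ^ χ)
    (hχ₀ : χ₀ ∈ Set.Ioc (0:ℝ) (1/2) ∧ (1+χ)^χ * (1-χ₀)^(1+χ) - χ₀^χ = 0)
    (hsmall : υ ≤ χ₀)
    (hϱ : ϱ = φ * (1+χ) * (1-υ) / ((1+χ) - (2+χ)*υ))
    (hball : Metric.closedBall ustar ϱ ⊆ Dstar) :
    ∃ useq : ℕ → X, useq 0 = ustar ∧
      (∀ n : ℕ, useq n ∈ Metric.closedBall ustar ϱ ∧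
        ∃ Γ : Y →L[ℝ] X,
          (∀ x : X, Γ (G' (useq n) x) = x) ∧
          (∀ y : Y, G' (useq n) (Γ y) = y) ∧
          useq (n+1) = useq n - Γ (G (useq n))) ∧
      ∃ u ∈ Metric.closedBall ustar ϱ,
        Filter.Tendsto useq Filter.atTop (nhds u) ∧ G u = 0 := by
  obtain ⟨hχ0, -⟩ := hχ
  obtain ⟨⟨-, hχ₀half⟩, hroot⟩ := hχ₀
  have hφ0 : 0 ≤ φ := hφ ▸ norm_nonneg _
  have hκ0 : 0 ≤ κ := hκ ▸ norm_nonneg _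
  have hυ0 : 0 ≤ υ := by rw [hυ]; positivity
  have hυhalf : υ ≤ 1 / 2 := hsmall.trans hχ₀half
  have h1υ : 0 < 1 - υ := by linarith
  have hfactor := rpow_contraction_factor_le hχ0 hυ0 hsmall (by linarith) hroot
  set q := υ / ((1 + χ) * (1 - υ)) with hq
  have hq0 : 0 ≤ q := by positivity
  have hq1 : q < 1 := by
    rw [hq, div_lt_one (by positivity)]
    nlinarith
  have h1q : 0 < 1 - q := by linarith
  have hϱq : ϱ = φ / (1 - q) := by
    have hden : 0 < (1 + χ) - (2 + χ) * υ := by nlinarith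
    have h1q' : 1 - q = ((1 + χ) - (2 + χ) * υ) / ((1 + χ) * (1 - υ)) := by
      rw [hq]; field_simp; ring
    rw [hϱ, h1q', div_div_eq_mul_div, mul_assoc]
  let useq : ℕ → X := fun n =>
    Nat.rec ustar (fun _ u => u - (G' u).inverse (G u)) n
  have hsucc : ∀ n, useq (n + 1) = useq n - (G' (useq n)).inverse (G (useq n)) := fun _ => rfl
  have hpartial : ∀ n, φ * (1 - q ^ n) / (1 - q) ≤ ϱ := by
    intro n
    rw [hϱq]
    gcongr
    nlinarith [pow_nonneg hq0 n]
  have hinv : ∀ n, dist (useq n) ustar ≤ φ * (1 - q ^ n) / (1 - q) ∧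
      ∃ Γ : Y →L[ℝ] X, (G' (useq n)).inverse = Γ ∧
        (∀ x, Γ (G' (useq n) x) = x) ∧ (∀ y, G' (useq n) (Γ y) = y) ∧
        ‖Γ (G (useq n))‖ ≤ φ * q ^ n ∧ ‖Γ‖ * lam * ‖Γ (G (useq n))‖ ^ χ ≤ υ := by
    intro n
    induction n with
    | zero =>
      refine ⟨by simp [useq], Γstar, ?_, hΓ_left, hΓ_right, ?_, ?_⟩
      · exact ContinuousLinearMap.inverse_eq (ContinuousLinearMap.ext hΓ_right)
          (ContinuousLinearMap.ext hΓ_left)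
      · simp [useq, hφ]
      · have h0 : ‖Γstar‖ * lam * ‖Γstar (G ustar)‖ ^ χ ≤ υ := by rw [hυ, hκ, hφ]
        exact h0
    | succ n ih =>
      obtain ⟨hdist, Γ, hΓ, hl, hr, hstep, hsm⟩ := ih
      have huv : useq (n + 1) = useq n - Γ (G (useq n)) := by rw [hsucc, hΓ]
      have hdist' : dist (useq (n + 1)) ustar ≤ φ * (1 - q ^ (n + 1)) / (1 - q) := by
        have h1 : dist (useq (n + 1)) (useq n) ≤ φ * q ^ n := by
          rw [huv, dist_eq_norm, sub_sub_cancel_left, norm_neg]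
          exact hstep
        calc dist (useq (n + 1)) ustar
            ≤ dist (useq (n + 1)) (useq n) + dist (useq n) ustar := dist_triangle _ _ _
          _ ≤ φ * q ^ n + φ * (1 - q ^ n) / (1 - q) := add_le_add h1 hdist
          _ = φ * (1 - q ^ (n + 1)) / (1 - q) := by
            field_simp; ring
      obtain ⟨Δ, hΔl, hΔr, hΔs, hΔsm⟩ := newton_step_of_holder hDconv hdiff hχ0 hlam.le hHolder
        hυ0 (by linarith) hfactor (hball (hdist.trans (hpartial n)))
        (hball (hdist'.trans (hpartial (n + 1)))) hl hr huv hsm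
      refine ⟨hdist', Δ, ContinuousLinearMap.inverse_eq (ContinuousLinearMap.ext hΔr)
          (ContinuousLinearMap.ext hΔl), hΔl, hΔr, ?_, hΔsm⟩
      calc ‖Δ (G (useq (n + 1)))‖ ≤ q * ‖Γ (G (useq n))‖ := hΔs
        _ ≤ q * (φ * q ^ n) := by gcongr
        _ = φ * q ^ (n + 1) := by ring
  have hmem : ∀ n, useq n ∈ Metric.closedBall ustar ϱ := fun n =>
    (hinv n).1.trans (hpartial n)
  have hcauchy : CauchySeq useq := by
    refine cauchySeq_of_le_geometric q φ hq1 fun n => ?_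
    obtain ⟨-, Γ, hΓ, -, -, hstep, -⟩ := hinv n
    rw [hsucc, hΓ, dist_eq_norm, sub_sub_cancel]
    exact hstep
  obtain ⟨u, hu⟩ := cauchySeq_tendsto_of_complete hcauchy
  have hu_mem : u ∈ Metric.closedBall ustar ϱ :=
    Metric.isClosed_closedBall.mem_of_tendsto hu (Filter.Eventually.of_forall hmem)
  refine ⟨useq, rfl, fun n => ⟨hmem n, ?_⟩, u, hu_mem, hu, ?_⟩
  · obtain ⟨-, Γ, hΓ, hl, hr, -, -⟩ := hinv n
    exact ⟨Γ, hl, hr, by rw [hsucc, hΓ]⟩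
  · have hGlim : Filter.Tendsto (fun n => G (useq (n + 1))) Filter.atTop (nhds (G u)) :=
      (hdiff u (hball hu_mem)).continuousAt.tendsto.comp
        (hu.comp (Filter.tendsto_add_atTop_nat 1))
    have hbound : ∀ n, ‖G (useq (n + 1))‖ ≤
        lam / (1 + χ) * ‖useq (n + 1) - useq n‖ ^ (1 + χ) := by
      intro n
      have h := norm_taylor_remainder_le_of_holder hDconv hdiff hχ0 hHolder
        (hball (hmem n)) (hball (hmem (n + 1)))
      obtain ⟨-, Γ, hΓ, -, hr, -, -⟩ := hinv n
      have hlin : G' (useq n) (useq (n + 1) - useq n) = -G (useq n) := by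
        rw [hsucc, hΓ, sub_sub_cancel_left, map_neg, hr]
      rw [hlin] at h
      simpa using h
    have hdiff0 : Filter.Tendsto (fun n => lam / (1 + χ) * ‖useq (n + 1) - useq n‖ ^ (1 + χ))
        Filter.atTop (nhds 0) := by
      have h1 := ((hu.comp (Filter.tendsto_add_atTop_nat 1)).sub hu).norm
      rw [sub_self, norm_zero] at h1
      have h2 := (h1.rpow_const (p := 1 + χ) (Or.inr (by linarith))).const_mul (lam / (1 + χ))
      rwa [Real.zero_rpow (by linarith), mul_zero] at h2
    exact tendsto_nhds_unique hGlim (squeeze_zero_norm hbound hdiff0)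
end

section
/- Under the stated hypotheses (Fréchet differentiability of G on D*, χ-Hölder continuity of G' with constant λ, invertibility of G'_{u*} with inverse Γ*, 0 < υ = κλφ^χ ≤ χ₀, and the closed ball of radius ϱ = φ(1+χ)(1−υ)/((1+χ)−(2+χ)υ) around u* contained in D*), the zero of G is unique in B_{ϱ̃}(u*) ∩ D* with ϱ̃ = φ υ^{−1/χ}: if u₁ and u₂ both belong to the open ball of radius ϱ̃ around u* intersected with D* and satisfy G(u₁) = 0 and G(u₂) = 0, then u₁ = u₂. -/
/-- A map with Hölder continuous derivative is injective on a convex set as long as its derivative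
stays close enough to an invertible derivative at a reference point. -/
theorem eq_of_hasFDerivAt_of_holder_of_lt_one {X Y : Type*}
    [NormedAddCommGroup X] [NormedSpace ℝ X] [NormedAddCommGroup Y] [NormedSpace ℝ Y]
    {D : Set X} (hD : Convex ℝ D) {G : X → Y} {G' : X → X →L[ℝ] Y}
    (hG : ∀ u ∈ D, HasFDerivAt G (G' u) u) {χ lam r : ℝ} (hχ : 0 ≤ χ) (hlam : 0 ≤ lam)
    {a : X} (hHolder : ∀ u ∈ D, ‖G' a - G' u‖ ≤ lam * ‖a - u‖ ^ χ)
    {L : Y →L[ℝ] X} (hL : ∀ x, L (G' a x) = x) (hr : ‖L‖ * (lam * r ^ χ) < 1)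
    {u v : X} (hu : u ∈ D ∩ Metric.closedBall a r) (hv : v ∈ D ∩ Metric.closedBall a r)
    (huv : G u = G v) : u = v := by
  have hderiv : ∀ x ∈ D ∩ Metric.closedBall a r, HasFDerivWithinAt (fun x => x - L (G x))
      (L.comp (G' a - G' x)) (D ∩ Metric.closedBall a r) x := by
    intro x hx
    have h := (hasFDerivAt_id (𝕜 := ℝ) x).sub (L.hasFDerivAt.comp x (hG x hx.1))
    have heq : L.comp (G' a - G' x) = ContinuousLinearMap.id ℝ X - L.comp (G' x) := by
      ext z
      simp [hL]
    rw [heq]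
    exact h.hasFDerivWithinAt
  have hbound : ∀ x ∈ D ∩ Metric.closedBall a r,
      ‖L.comp (G' a - G' x)‖ ≤ ‖L‖ * (lam * r ^ χ) := by
    intro x hx
    have hxr : ‖a - x‖ ≤ r := by
      rw [← dist_eq_norm, dist_comm]
      exact hx.2
    refine (L.opNorm_comp_le _).trans ?_
    have := hHolder x hx.1
    have hpow := Real.rpow_le_rpow (norm_nonneg (a - x)) hxr hχ
    gcongr
    exact this.trans (by gcongr)
  have hmv := (hD.inter (convex_closedBall a r)).norm_image_sub_le_of_norm_hasFDerivWithin_le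
    hderiv hbound hv hu
  simp only [huv, sub_sub_sub_cancel_right] at hmv
  by_contra hne
  have hpos : 0 < ‖u - v‖ := norm_pos_iff.2 (sub_ne_zero.2 hne)
  nlinarith

/-- Generalized Newton–Kantorovich theorem (uniqueness part): under the same hypotheses
with `0 < υ = κλφ^χ ≤ χ₀`, the zero of `G` is unique in `B_{ϱ̃}(u*) ∩ D*` with
`ϱ̃ = φ υ^{-1/χ}`. -/
theorem stmt_2 {X Y : Type*}
    [NormedAddCommGroup X] [NormedSpace ℝ X] [CompleteSpace X]
    [NormedAddCommGroup Y] [NormedSpace ℝ Y] [CompleteSpace Y]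
    (Dstar : Set X) (hDopen : IsOpen Dstar) (hDconv : Convex ℝ Dstar)
    (G : X → Y) (G' : X → X →L[ℝ] Y)
    (hdiff : ∀ u ∈ Dstar, HasFDerivAt G (G' u) u)
    (χ lam : ℝ) (hχ : χ ∈ Set.Ioc (0:ℝ) 1) (hlam : 0 < lam)
    (hHolder : ∀ u₁ ∈ Dstar, ∀ u₂ ∈ Dstar,
      ‖G' u₁ - G' u₂‖ ≤ lam * ‖u₁ - u₂‖ ^ χ)
    (ustar : X) (hustar : ustar ∈ Dstar)
    (Γstar : Y →L[ℝ] X)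
    (hΓ_left : ∀ x : X, Γstar (G' ustar x) = x)
    (hΓ_right : ∀ y : Y, G' ustar (Γstar y) = y)
    (κ φ υ χ₀ ϱ ϱt : ℝ)
    (hκ : κ = ‖Γstar‖) (hφ : φ = ‖Γstar (G ustar)‖)
    (hυ : υ = κ * lam * φ ^ χ) (hυpos : 0 < υ)
    (hχ₀ : χ₀ ∈ Set.Ioc (0:ℝ) (1/2) ∧ (1+χ)^χ * (1-χ₀)^(1+χ) - χ₀^χ = 0)
    (hsmall : υ ≤ χ₀)
    (hϱ : ϱ = φ * (1+χ) * (1-υ) / ((1+χ) - (2+χ)*υ))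
    (hball : Metric.closedBall ustar ϱ ⊆ Dstar)
    (hϱt : ϱt = φ * υ ^ (-(1/χ))) :
    ∀ u₁ ∈ Metric.ball ustar ϱt ∩ Dstar,
      ∀ u₂ ∈ Metric.ball ustar ϱt ∩ Dstar,
        G u₁ = 0 → G u₂ = 0 → u₁ = u₂ := by
  intro u₁ hu₁ u₂ hu₂ h₁ h₂
  obtain ⟨hχpos, -⟩ := hχ
  have hφ0 : 0 ≤ φ := hφ ▸ norm_nonneg _
  have hκ0 : 0 ≤ κ := hκ ▸ norm_nonneg _
  have hκpos : 0 < κ := by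
    refine lt_of_le_of_ne hκ0 fun h => ?_
    rw [hυ, ← h] at hυpos
    simp at hυpos
  have hpow : ϱt ^ χ = φ ^ χ * υ⁻¹ := by
    rw [hϱt, Real.mul_rpow hφ0 (Real.rpow_nonneg hυpos.le _), ← Real.rpow_mul hυpos.le,
      show -(1 / χ) * χ = -1 by field_simp, Real.rpow_neg_one]
  have hr : max (dist u₁ ustar) (dist u₂ ustar) < ϱt := max_lt hu₁.1 hu₂.1
  have hlt := Real.rpow_lt_rpow (le_max_of_le_left dist_nonneg) hr hχpos
  refine eq_of_hasFDerivAt_of_holder_of_lt_one (r := max (dist u₁ ustar) (dist u₂ ustar))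
    hDconv hdiff hχpos.le hlam.le
    (hHolder ustar hustar) hΓ_left ?_ ⟨hu₁.2, Metric.mem_closedBall.2 (le_max_left _ _)⟩
    ⟨hu₂.2, Metric.mem_closedBall.2 (le_max_right _ _)⟩
    (h₁.trans h₂.symm)
  calc ‖Γstar‖ * (lam * max (dist u₁ ustar) (dist u₂ ustar) ^ χ)
      < κ * (lam * ϱt ^ χ) := by
        rw [← hκ]
        gcongr
    _ = υ * υ⁻¹ := by
        rw [hpow, hυ]
        ring
    _ = 1 := mul_inv_cancel₀ hυpos.ne'
end

section
/- Let α, ε > 0, Z₀ = √(ε/α), and let n = (n₁, n₂) ∈ ℝ² be a unit vector. The matrix −Aₙᵘᵖ has the eigenpairs: eigenvalue 0 with eigenvectors e₁ = (Z₀n₁, 1, 0) and e₂ = (Z₀n₂, 0, 1), and eigenvalue (1/2)(Z₀ + 1/Z₀) with eigenvector e₃ = (−1/Z₀, n₁, n₂); that is, (−Aₙᵘᵖ)e₁ = 0, (−Aₙᵘᵖ)e₂ = 0, and (−Aₙᵘᵖ)e₃ = (1/2)(Z₀ + 1/Z₀)·e₃. Moreover the vectors e₁, e₂, e₃ are linearly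 independent in ℝ³. -/
/-- Eigenpairs of `-Aₙᵘᵖ`: eigenvalue `0` with eigenvectors `e₁ = (Z₀n₁, 1, 0)`,
`e₂ = (Z₀n₂, 0, 1)`, and eigenvalue `(1/2)(Z₀ + 1/Z₀)` with eigenvector
`e₃ = (-1/Z₀, n₁, n₂)`; moreover `e₁, e₂, e₃` are linearly independent. -/
theorem stmt_6 (α ε : ℝ) (hα : 0 < α) (hε : 0 < ε)
    (Z₀ : ℝ) (hZ₀ : Z₀ = Real.sqrt (ε / α))
    (n₁ n₂ : ℝ) (hn : n₁^2 + n₂^2 = 1)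
    (Aup : Matrix (Fin 3) (Fin 3) ℝ)
    (hAup : Aup = (1/2 : ℝ) •
      !![-(1/Z₀), n₁, n₂;
         n₁, -(Z₀*n₁^2), -(Z₀*n₁*n₂);
         n₂, -(Z₀*n₁*n₂), -(Z₀*n₂^2)])
    (e₁ e₂ e₃ : Fin 3 → ℝ)
    (he₁ : e₁ = ![Z₀*n₁, 1, 0])
    (he₂ : e₂ = ![Z₀*n₂, 0, 1])
    (he₃ : e₃ = ![-(1/Z₀), n₁, n₂]) :
    (-Aup).mulVec e₁ = 0 ∧
    (-Aup).mulVec e₂ = 0 ∧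
    (-Aup).mulVec e₃ = ((1/2) * (Z₀ + 1/Z₀)) • e₃ ∧
    LinearIndependent ℝ ![e₁, e₂, e₃] := by
  have hZ : 0 < Z₀ := hZ₀ ▸ Real.sqrt_pos.mpr (div_pos hε hα)
  subst hAup he₁ he₂ he₃
  refine ⟨?_, ?_, ?_, ?_⟩
  · ext i
    fin_cases i <;> simp [Matrix.mulVec, dotProduct, Fin.sum_univ_three] <;> field_simp <;> ring
  · ext i
    fin_cases i <;> simp [Matrix.mulVec, dotProduct, Fin.sum_univ_three] <;> field_simp <;> ring
  · ext i
    fin_cases i <;> simp [Matrix.mulVec, dotProduct, Fin.sum_univ_three] <;> field_simp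
    · linear_combination (-Z₀ ^ 2) * hn
    · linear_combination (n₁ * Z₀ ^ 2) * hn
    · linear_combination (n₂ * Z₀ ^ 2) * hn
  · have hdet : (Matrix.of ![![Z₀*n₁, 1, 0], ![Z₀*n₂, 0, 1], ![-(1/Z₀), n₁, n₂]]).det
        = -(Z₀ + 1/Z₀) := by
      simp [Matrix.det_fin_three]
      linear_combination (-Z₀) * hn
    refine Matrix.linearIndependent_rows_of_det_ne_zero
      (A := Matrix.of ![![Z₀*n₁, 1, 0], ![Z₀*n₂, 0, 1], ![-(1/Z₀), n₁, n₂]]) ?_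
    rw [hdet]
    exact neg_ne_zero.mpr (by positivity)
end

section
/- Let α, ε > 0, Z₀ = √(ε/α), and let n = (n₁, n₂) ∈ ℝ² be a unit vector. The matrix −Aₙᵘᵖ is symmetric positive semidefinite; more precisely, for every y = (y₁, y₂, y₃) ∈ ℝ³, the quadratic form satisfies yᵀ(−Aₙᵘᵖ)y = (1/(2Z₀)) (y₁ − Z₀(n₁y₂ + n₂y₃))² ≥ 0. -/
open Matrix

/-- The matrix `-Aₙᵘᵖ` is symmetric positive semidefinite: for every `y ∈ ℝ³`,
`yᵀ(-Aₙᵘᵖ)y = (1/(2Z₀))(y₁ - Z₀(n₁y₂ + n₂y₃))² ≥ 0`. -/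
theorem stmt_7 (α ε : ℝ) (hα : 0 < α) (hε : 0 < ε)
    (Z₀ : ℝ) (hZ₀ : Z₀ = Real.sqrt (ε / α))
    (n₁ n₂ : ℝ) (hn : n₁^2 + n₂^2 = 1)
    (Aup : Matrix (Fin 3) (Fin 3) ℝ)
    (hAup : Aup = (1/2 : ℝ) •
      !![-(1/Z₀), n₁, n₂;
         n₁, -(Z₀*n₁^2), -(Z₀*n₁*n₂);
         n₂, -(Z₀*n₁*n₂), -(Z₀*n₂^2)]) :
    (-Aup).IsSymm ∧
    ∀ y : Fin 3 → ℝ,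
      y ⬝ᵥ (-Aup).mulVec y = (1/(2*Z₀)) * (y 0 - Z₀*(n₁ * y 1 + n₂ * y 2))^2 ∧
      0 ≤ y ⬝ᵥ (-Aup).mulVec y := by
  have hZ : 0 < Z₀ := hZ₀ ▸ Real.sqrt_pos.mpr (div_pos hε hα)
  subst hAup
  refine ⟨?_, fun y => ?_⟩
  · ext i j
    fin_cases i <;> fin_cases j <;> simp
  · have key : y ⬝ᵥ (-((1/2 : ℝ) •
        !![-(1/Z₀), n₁, n₂;
           n₁, -(Z₀*n₁^2), -(Z₀*n₁*n₂);
           n₂, -(Z₀*n₁*n₂), -(Z₀*n₂^2)])).mulVec y =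
        (1/(2*Z₀)) * (y 0 - Z₀*(n₁ * y 1 + n₂ * y 2))^2 := by
      simp [dotProduct, mulVec, Fin.sum_univ_three]
      field_simp
      ring
    exact ⟨key, key ▸ by positivity⟩
end

section
/- Let α, ε > 0, Z₀ = √(ε/α), let n = (n₁, n₂) ∈ ℝ² be a unit vector, and set w = (1, −Z₀n₁, −Z₀n₂). Then the matrix S = (2Z₀(1 + Z₀²))^{−1/2} · w wᵀ is symmetric positive semidefinite and satisfies S² = −Aₙᵘᵖ; that is, S is a square root of −Aₙᵘᵖ. -/
open Matrix

/-- With `w = (1, -Z₀n₁, -Z₀n₂)`, the matrix `S = (2Z₀(1+Z₀²))^{-1/2} w wᵀ` is a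
symmetric positive semidefinite square root of `-Aₙᵘᵖ`. -/
theorem stmt_8 (α ε : ℝ) (hα : 0 < α) (hε : 0 < ε)
    (Z₀ : ℝ) (hZ₀ : Z₀ = Real.sqrt (ε / α))
    (n₁ n₂ : ℝ) (hn : n₁^2 + n₂^2 = 1)
    (Aup : Matrix (Fin 3) (Fin 3) ℝ)
    (hAup : Aup = (1/2 : ℝ) •
      !![-(1/Z₀), n₁, n₂;
         n₁, -(Z₀*n₁^2), -(Z₀*n₁*n₂);
         n₂, -(Z₀*n₁*n₂), -(Z₀*n₂^2)])
    (w : Fin 3 → ℝ) (hw : w = ![1, -(Z₀*n₁), -(Z₀*n₂)])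
    (S : Matrix (Fin 3) (Fin 3) ℝ)
    (hS : S = (1 / Real.sqrt (2*Z₀*(1+Z₀^2))) • Matrix.vecMulVec w w) :
    S.IsSymm ∧ (∀ y : Fin 3 → ℝ, 0 ≤ y ⬝ᵥ S.mulVec y) ∧ S * S = -Aup := by
  have hZ : 0 < Z₀ := hZ₀ ▸ Real.sqrt_pos.mpr (div_pos hε hα)
  have hww : w ⬝ᵥ w = 1 + Z₀^2 := by
    simp only [hw, dotProduct, Fin.sum_univ_three, cons_val]
    linear_combination Z₀^2 * hn
  refine ⟨?_, fun y ↦ ?_, ?_⟩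
  · rw [hS, Matrix.IsSymm, transpose_smul, transpose_vecMulVec]
  · rw [hS]
    have hpsd : (vecMulVec w w).PosSemidef := by
      simpa using posSemidef_vecMulVec_self_star w
    have hy := hpsd.dotProduct_mulVec_nonneg y
    rw [star_trivial] at hy
    rw [smul_mulVec, dotProduct_smul, smul_eq_mul]
    positivity
  · have hc : 1 / √(2*Z₀*(1+Z₀^2)) * (1 / √(2*Z₀*(1+Z₀^2))) * (1 + Z₀^2) = 1 / (2 * Z₀) := by
      rw [div_mul_div_comm, Real.mul_self_sqrt (by positivity)]
      field_simp
    have hSS : S * S = (1 / (2 * Z₀)) • vecMulVec w w := by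
      rw [hS, smul_mul_smul_comm, vecMulVec_mul_vecMulVec, hww, vecMulVec_smul, smul_smul, hc]
    rw [hSS, hAup, hw]
    ext i j
    fin_cases i <;> fin_cases j <;> simp <;> field_simp
end

section
/- Let d ≥ 1 be an integer, let γ, δ, η, θ > 0 and set μ = max{γ, δ, η, θ}. For g ∈ ℝ^d, J ∈ ℝ^{d×d} and z = (z_p, z_v) ∈ ℝ × ℝ^d, define N := (γ z_p tr(J) + δ g·z_v, η Jᵀz_v − θ z_p g) ∈ ℝ × ℝ^d. Then ‖N‖ ≤ μ √(d+1) · √(‖g‖² + ‖J‖_F²) · ‖z‖, where ‖J‖_F denotes the Frobenius norm of J and ‖z‖² = z_p² + ‖z_v‖². -/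
/-- Minkowski-type bound for a weighted difference of two finite families. -/
lemma sum_sq_weighted_sub_le {ι : Type*} [Fintype ι] {η θ μ A B : ℝ} (hη : 0 ≤ η) (hθ : 0 ≤ θ)
    (hημ : η ≤ μ) (hθμ : θ ≤ μ) (hA : 0 ≤ A) (hB : 0 ≤ B) (x y : ι → ℝ)
    (hx : ∑ i, x i ^ 2 ≤ A ^ 2) (hy : ∑ i, y i ^ 2 ≤ B ^ 2) :
    ∑ i, (η * x i - θ * y i) ^ 2 ≤ μ ^ 2 * (A + B) ^ 2 := by
  have pointwise : ∀ i, (η * x i - θ * y i) ^ 2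
      ≤ μ ^ 2 * (x i ^ 2 + y i ^ 2 + 2 * (|x i| * |y i|)) := by
    intro i
    have h : |η * x i - θ * y i| ≤ μ * (|x i| + |y i|) := by
      calc |η * x i - θ * y i| ≤ |η * x i| + |θ * y i| := abs_sub _ _
        _ = η * |x i| + θ * |y i| := by
          rw [abs_mul, abs_mul, abs_of_nonneg hη, abs_of_nonneg hθ]
        _ ≤ μ * |x i| + μ * |y i| := by gcongr
        _ = μ * (|x i| + |y i|) := by ring
    calc (η * x i - θ * y i) ^ 2 = |η * x i - θ * y i| ^ 2 := (sq_abs _).symm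
      _ ≤ (μ * (|x i| + |y i|)) ^ 2 := by gcongr
      _ = μ ^ 2 * (|x i| ^ 2 + |y i| ^ 2 + 2 * (|x i| * |y i|)) := by ring
      _ = _ := by rw [sq_abs, sq_abs]
  have cross : ∑ i, |x i| * |y i| ≤ A * B := by
    refine le_of_sq_le_sq ?_ (by positivity)
    calc (∑ i, |x i| * |y i|) ^ 2 ≤ (∑ i, |x i| ^ 2) * ∑ i, |y i| ^ 2 :=
          Finset.sum_mul_sq_le_sq_mul_sq _ _ _
      _ = (∑ i, x i ^ 2) * ∑ i, y i ^ 2 := by simp only [sq_abs]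
      _ ≤ A ^ 2 * B ^ 2 := by gcongr
      _ = (A * B) ^ 2 := by ring
  calc ∑ i, (η * x i - θ * y i) ^ 2
      ≤ ∑ i, μ ^ 2 * (x i ^ 2 + y i ^ 2 + 2 * (|x i| * |y i|)) :=
        Finset.sum_le_sum fun i _ => pointwise i
    _ = μ ^ 2 * (∑ i, x i ^ 2 + ∑ i, y i ^ 2 + 2 * ∑ i, |x i| * |y i|) := by
        rw [← Finset.mul_sum, Finset.sum_add_distrib, Finset.sum_add_distrib, Finset.mul_sum]
    _ ≤ μ ^ 2 * (A ^ 2 + B ^ 2 + 2 * (A * B)) := by gcongr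
    _ = μ ^ 2 * (A + B) ^ 2 := by ring

/-- A nonnegative real number is the square of a nonnegative one. -/
lemma exists_nonneg_eq_sq {x : ℝ} (hx : 0 ≤ x) : ∃ r : ℝ, 0 ≤ r ∧ x = r ^ 2 :=
  ⟨√x, Real.sqrt_nonneg x, (Real.sq_sqrt hx).symm⟩

/-- The scalar inequality behind the dimension factor, with `s ^ 2` as the dimension. -/
lemma sq_add_sq_le_of_one_le_sq {s a b G F : ℝ} (hs : 1 ≤ s ^ 2) :
    (a * (s * F) + G * b) ^ 2 + (F * b + a * G) ^ 2
      ≤ (s ^ 2 + 1) * (G ^ 2 + F ^ 2) * (a ^ 2 + b ^ 2) := by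
  have hsb : 0 ≤ (s ^ 2 - 1) * (b ^ 2 * (G ^ 2 + F ^ 2)) :=
    mul_nonneg (by linarith) (by positivity)
  linarith [sq_nonneg (s * G * a - b * F), sq_nonneg (G * b - a * F)]

/-- Bound for a weighted sum of a product and a scalar. -/
lemma sq_weighted_add_le {γ δ μ z t p T P : ℝ} (hγ : 0 ≤ γ) (hδ : 0 ≤ δ)
    (hγμ : γ ≤ μ) (hδμ : δ ≤ μ) (ht : |t| ≤ T) (hp : |p| ≤ P) :
    (γ * z * t + δ * p) ^ 2 ≤ μ ^ 2 * (|z| * T + P) ^ 2 := by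
  have hμ : 0 ≤ μ := hγ.trans hγμ
  have hT : 0 ≤ T := (abs_nonneg t).trans ht
  rw [← mul_pow, ← sq_abs]
  gcongr
  calc |γ * z * t + δ * p| ≤ |γ * z * t| + |δ * p| := abs_add_le _ _
    _ = γ * (|z| * |t|) + δ * |p| := by
      rw [abs_mul, abs_mul, abs_mul, abs_of_nonneg hγ, abs_of_nonneg hδ, mul_assoc]
    _ ≤ μ * (|z| * T) + μ * P := by gcongr
    _ = μ * (|z| * T + P) := by ring

/-- The transpose of a matrix acts with operator norm at most its Frobenius norm. -/
lemma sum_sq_transpose_mulVec_le {m n : Type*} [Fintype m] [Fintype n]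
    (J : Matrix m n ℝ) (v : m → ℝ) :
    ∑ i, (∑ j, J j i * v j) ^ 2 ≤ (∑ i, ∑ j, J i j ^ 2) * ∑ j, v j ^ 2 := by
  rw [Finset.sum_comm, Finset.sum_mul]
  exact Finset.sum_le_sum fun i _ => Finset.sum_mul_sq_le_sq_mul_sq _ _ _

/-- The squared trace is at most the dimension times the squared Frobenius norm. -/
lemma sq_sum_diag_le {n : Type*} [Fintype n] (J : Matrix n n ℝ) :
    (∑ i, J i i) ^ 2 ≤ Fintype.card n * ∑ i, ∑ j, J i j ^ 2 := by
  calc (∑ i, J i i) ^ 2 ≤ Fintype.card n * ∑ i, J i i ^ 2 := sq_sum_le_card_mul_sum_sq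
    _ ≤ Fintype.card n * ∑ i, ∑ j, J i j ^ 2 := by
      gcongr with i
      exact Finset.single_le_sum (f := fun j => J i j ^ 2) (fun j _ => sq_nonneg _)
        (Finset.mem_univ i)

/-- Pointwise bound for the quadratic nonlinearity of the acoustic model:
`‖N‖ ≤ μ √(d+1) √(‖g‖² + ‖J‖_F²) ‖z‖` where
`N = (γ z_p tr J + δ g·z_v, η Jᵀ z_v - θ z_p g)`. -/
theorem stmt_10 (d : ℕ) (hd : 1 ≤ d)
    (γ δ η θ : ℝ) (hγ : 0 < γ) (hδ : 0 < δ) (hη : 0 < η) (hθ : 0 < θ)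
    (μ : ℝ) (hμ : μ = max (max γ δ) (max η θ))
    (g : Fin d → ℝ) (J : Matrix (Fin d) (Fin d) ℝ) (zp : ℝ) (zv : Fin d → ℝ) :
    Real.sqrt ((γ * zp * (∑ i, J i i) + δ * (∑ i, g i * zv i))^2
        + ∑ i, (η * (∑ j, J j i * zv j) - θ * (zp * g i))^2)
      ≤ μ * Real.sqrt ((d : ℝ) + 1)
        * Real.sqrt ((∑ i, (g i)^2) + ∑ i, ∑ j, (J i j)^2)
        * Real.sqrt (zp^2 + ∑ i, (zv i)^2) := by
  have hγμ : γ ≤ μ := by rw [hμ]; simp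
  have hδμ : δ ≤ μ := by rw [hμ]; simp
  have hημ : η ≤ μ := by rw [hμ]; simp
  have hθμ : θ ≤ μ := by rw [hμ]; simp
  have hμ0 : 0 < μ := hγ.trans_le hγμ
  have hd' : (1 : ℝ) ≤ d := by exact_mod_cast hd
  obtain ⟨G, hG, hGe⟩ : ∃ G : ℝ, 0 ≤ G ∧ ∑ i, g i ^ 2 = G ^ 2 :=
    exists_nonneg_eq_sq (by positivity)
  obtain ⟨F, hF, hFe⟩ : ∃ F : ℝ, 0 ≤ F ∧ ∑ i, ∑ j, J i j ^ 2 = F ^ 2 :=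
    exists_nonneg_eq_sq (by positivity)
  obtain ⟨b, hb, hbe⟩ : ∃ b : ℝ, 0 ≤ b ∧ ∑ i, zv i ^ 2 = b ^ 2 :=
    exists_nonneg_eq_sq (by positivity)
  obtain ⟨s, hs, hse⟩ : ∃ s : ℝ, 0 ≤ s ∧ (d : ℝ) = s ^ 2 := exists_nonneg_eq_sq d.cast_nonneg
  have trace_le : |∑ i, J i i| ≤ s * F := by
    refine abs_le_of_sq_le_sq ?_ (by positivity)
    have h := sq_sum_diag_le J
    rwa [Fintype.card_fin, hFe, hse, ← mul_pow] at h
  have inner_le : |∑ i, g i * zv i| ≤ G * b := by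
    refine abs_le_of_sq_le_sq ?_ (by positivity)
    have h := Finset.sum_mul_sq_le_sq_mul_sq Finset.univ g zv
    rwa [hGe, hbe, ← mul_pow] at h
  have first_le : (γ * zp * (∑ i, J i i) + δ * (∑ i, g i * zv i)) ^ 2
      ≤ μ ^ 2 * (|zp| * (s * F) + G * b) ^ 2 :=
    sq_weighted_add_le hγ.le hδ.le hγμ hδμ trace_le inner_le
  have second_le : ∑ i, (η * (∑ j, J j i * zv j) - θ * (zp * g i)) ^ 2
      ≤ μ ^ 2 * (F * b + |zp| * G) ^ 2 := by
    refine sum_sq_weighted_sub_le hη.le hθ.le hημ hθμ (by positivity) (by positivity) _ _ ?_ ?_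
    · rw [mul_pow, ← hFe, ← hbe]
      exact sum_sq_transpose_mulVec_le J zv
    · simp only [mul_pow, sq_abs, ← Finset.mul_sum, hGe, le_refl]
  rw [hGe, hFe, hbe]
  refine Real.sqrt_le_iff.mpr ⟨by positivity, ?_⟩
  rw [mul_pow, mul_pow, mul_pow, Real.sq_sqrt (by positivity), Real.sq_sqrt (by positivity),
    Real.sq_sqrt (by positivity), hse, ← sq_abs zp]
  calc _ ≤ μ ^ 2 * ((|zp| * (s * F) + G * b) ^ 2 + (F * b + |zp| * G) ^ 2) := by
        rw [mul_add]; exact add_le_add first_le second_le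
    _ ≤ μ ^ 2 * ((s ^ 2 + 1) * (G ^ 2 + F ^ 2) * (|zp| ^ 2 + b ^ 2)) := by
        gcongr
        exact sq_add_sq_le_of_one_le_sq (hse ▸ hd')
    _ = _ := by ring
end
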